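/- If P and Q are strongly complementary permutation matrices of order n, then n is even. -/

import Mathlib

open Matrix

/-- Two (permutation) matrices are complementary if
`P_{ij} = P_{hk} = Q_{ik} = 1` implies `Q_{hj} = 1`. -/
def Complementary {n : ℕ} (P Q : Matrix (Fin n) (Fin n) ℝ) : Prop :=
  ∀ i j h k : Fin n, P i j = 1 → P h k = 1 → Q i k = 1 → Q h j = 1

/-- Two (permutation) matrices are strongly complementary if they are
complementary and their nonzero entries are in different places. -/
def StronglyComplementary {n : ℕ} (P Q : Matrix (Fin n) (Fin n) ℝ) : Prop :=
  Complementary P Q ∧ ∀ i j : Fin n, P i j = 1 → Q i j = 0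

theorem permMatrix_apply_eq_one_iff {n : ℕ} (σ : Equiv.Perm (Fin n)) (i j : Fin n) :
    σ.permMatrix ℝ i j = 1 ↔ σ i = j := by
  simp [Equiv.Perm.permMatrix, PEquiv.toMatrix_apply, eq_comm]

/-- If two permutation matrices of order `n` are strongly complementary,
then `n` is even. -/
theorem strongly_complementary_even {n : ℕ} (σ τ : Equiv.Perm (Fin n))
    (h : StronglyComplementary (σ.permMatrix ℝ) (τ.permMatrix ℝ)) :
    Even n := by
  obtain ⟨hcompl, hdisj⟩ := h
  have hinv : ∀ i, τ (σ.symm (τ i)) = σ i := fun i => by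
    have := hcompl i (σ i) (σ.symm (τ i)) (τ i)
    simpa only [permMatrix_apply_eq_one_iff, Equiv.apply_symm_apply, forall_const] using this
  have hne : ∀ i, τ i ≠ σ i := fun i hi => by
    have h0 := hdisj i (σ i) ((permMatrix_apply_eq_one_iff σ i _).2 rfl)
    rw [(permMatrix_apply_eq_one_iff τ i _).2 hi] at h0
    exact one_ne_zero h0
  -- `σ⁻¹ ∘ τ` is an involution without fixed points
  let f : Function.End (Fin n) := fun i => σ.symm (τ i)
  have hsq : f ^ 2 ^ 1 = 1 := by
    rw [pow_one, sq]
    funext i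
    exact σ.symm_apply_eq.2 (hinv i)
  have hfix : IsEmpty (Function.fixedPoints f) :=
    ⟨fun ⟨i, hi⟩ => hne i (σ.symm_apply_eq.1 hi)⟩
  have hmod := Equiv.Perm.card_fixedPoints_modEq hsq
  rw [Fintype.card_fin, Fintype.card_eq_zero] at hmod
  exact even_iff_two_dvd.2 (Nat.modEq_zero_iff_dvd.1 hmod)
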